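/- arXiv:1912.03684 — 6 statements merged into one kernel-verified Lean document; each statement's English description precedes it below -/
import Mathlib

section
/- Let $H \in (0,1)$. Then $\int_0^{\infty}\left(e^{-x^2/2}-1\right)^2 x^{-1-2H}\,dx = \Gamma(1-H)\, H^{-1}\,(2^{-H}-2^{-1})$. -/
open MeasureTheory Real

/-- `(exp (-x ^ 2 / 2) - 1) ^ 2` is at most `1`. -/
lemma sq_exp_neg_sq_div_two_sub_one_le_one (x : ℝ) : (exp (-x ^ 2 / 2) - 1) ^ 2 ≤ 1 := by
  have h1 : exp (-x ^ 2 / 2) ≤ 1 := exp_le_one_iff.2 (by nlinarith [sq_nonneg x])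
  nlinarith [exp_pos (-x ^ 2 / 2)]

/-- `(exp (-x ^ 2 / 2) - 1) ^ 2` vanishes to fourth order at the origin. -/
lemma sq_exp_neg_sq_div_two_sub_one_le_pow_four (x : ℝ) :
    (exp (-x ^ 2 / 2) - 1) ^ 2 ≤ x ^ 4 := by
  have h1 : exp (-x ^ 2 / 2) ≤ 1 := exp_le_one_iff.2 (by nlinarith [sq_nonneg x])
  have h2 := add_one_le_exp (-x ^ 2 / 2)
  have h3 : (1 - exp (-x ^ 2 / 2)) ^ 2 ≤ (x ^ 2) ^ 2 :=
    pow_le_pow_left₀ (by linarith) (by nlinarith [sq_nonneg x]) 2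
  nlinarith

lemma integrableOn_sq_exp_neg_sq_div_two_sub_one_mul_rpow {s : ℝ} (hs : -5 < s) (hs' : s < -1) :
    IntegrableOn (fun x : ℝ => (exp (-x ^ 2 / 2) - 1) ^ 2 * x ^ s) (Set.Ioi 0) := by
  have hmeas : Measurable fun x : ℝ => (exp (-x ^ 2 / 2) - 1) ^ 2 * x ^ s := by fun_prop
  rw [← Set.Ioc_union_Ioi_eq_Ioi zero_le_one]
  refine IntegrableOn.union ?_ ?_
  · have hint : IntegrableOn (fun x : ℝ => x ^ (4 + s)) (Set.Ioc 0 1) :=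
      (intervalIntegrable_iff_integrableOn_Ioc_of_le zero_le_one).1
        (intervalIntegral.intervalIntegrable_rpow' (by linarith))
    refine hint.mono' hmeas.aestronglyMeasurable ?_
    filter_upwards [ae_restrict_mem measurableSet_Ioc] with x hx
    have hx0 : 0 < x := hx.1
    rw [norm_of_nonneg (by positivity), rpow_add hx0, rpow_ofNat]
    gcongr
    exact sq_exp_neg_sq_div_two_sub_one_le_pow_four x
  · refine (integrableOn_Ioi_rpow_of_lt hs' one_pos).mono' hmeas.aestronglyMeasurable ?_
    filter_upwards [ae_restrict_mem measurableSet_Ioi] with x hx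
    have hx0 : 0 < x := one_pos.trans hx
    rw [norm_of_nonneg (by positivity)]
    exact mul_le_of_le_one_left (by positivity) (sq_exp_neg_sq_div_two_sub_one_le_one x)

lemma tendsto_sq_exp_neg_sq_div_two_sub_one_mul_rpow_nhdsGT {s : ℝ} (hs : -4 < s) :
    Filter.Tendsto (fun x : ℝ => (exp (-x ^ 2 / 2) - 1) ^ 2 * x ^ s)
      (nhdsWithin 0 (Set.Ioi 0)) (nhds 0) := by
  have hlim : Filter.Tendsto (fun x : ℝ => x ^ (4 + s)) (nhdsWithin 0 (Set.Ioi 0)) (nhds 0) := by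
    have h := (continuousAt_rpow_const (0 : ℝ) (4 + s) (Or.inr (by linarith))).tendsto
    rw [zero_rpow (by linarith)] at h
    exact h.mono_left nhdsWithin_le_nhds
  refine squeeze_zero' ?_ ?_ hlim
  · filter_upwards [self_mem_nhdsWithin] with x hx
    have hx0 : 0 < x := hx
    positivity
  · filter_upwards [self_mem_nhdsWithin] with x hx
    have hx0 : 0 < x := hx
    rw [rpow_add hx0, rpow_ofNat]
    gcongr
    exact sq_exp_neg_sq_div_two_sub_one_le_pow_four x

lemma tendsto_sq_exp_neg_sq_div_two_sub_one_mul_rpow_atTop {s : ℝ} (hs : s < 0) :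
    Filter.Tendsto (fun x : ℝ => (exp (-x ^ 2 / 2) - 1) ^ 2 * x ^ s) Filter.atTop (nhds 0) := by
  have hlim : Filter.Tendsto (fun x : ℝ => x ^ s) Filter.atTop (nhds 0) := by
    simpa using tendsto_rpow_neg_atTop (neg_pos.2 hs)
  refine squeeze_zero' ?_ ?_ hlim
  · filter_upwards [Filter.eventually_gt_atTop 0] with x hx
    positivity
  · filter_upwards [Filter.eventually_gt_atTop 0] with x hx
    exact mul_le_of_le_one_left (by positivity) (sq_exp_neg_sq_div_two_sub_one_le_one x)

theorem integral_sq_exp_neg_sq_div_two_sub_one (H : ℝ) (hH : H ∈ Set.Ioo (0:ℝ) 1) :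
    ∫ x in Set.Ioi (0:ℝ), (Real.exp (-x^2/2) - 1)^2 * x ^ (-1 - 2*H) =
      Real.Gamma (1 - H) * H⁻¹ * ((2:ℝ) ^ (-H) - 2⁻¹) := by
  obtain ⟨hH0, hH1⟩ := hH
  have hu (x : ℝ) : HasDerivAt (fun y : ℝ => (exp (-y ^ 2 / 2) - 1) ^ 2)
      (2 * (exp (-x ^ 2 / 2) - 1) * (exp (-x ^ 2 / 2) * -x)) x := by
    have h : HasDerivAt (fun y : ℝ => -y ^ 2 / 2) (-x) x := by
      convert! ((hasDerivAt_pow 2 x).neg.div_const 2) using 1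
      push_cast
      ring
    convert! (h.exp.sub_const 1).pow 2 using 1
    simp
  have hv (x : ℝ) (hx : x ∈ Set.Ioi (0 : ℝ)) :
      HasDerivAt (fun y : ℝ => y ^ (-2 * H) * (-2 * H)⁻¹) (x ^ (-1 - 2 * H)) x := by
    convert! (hasDerivAt_rpow_const (p := -2 * H) (Or.inl (ne_of_gt hx))).mul_const (-2 * H)⁻¹
      using 1
    rw [show -2 * H - 1 = -1 - 2 * H by ring]
    field_simp
  have hgauss (b : ℝ) (hb : 0 < b) :
      IntegrableOn (fun x : ℝ => x ^ (1 - 2 * H) * exp (-b * x ^ (2 : ℝ))) (Set.Ioi 0) :=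
    integrableOn_rpow_mul_exp_neg_mul_rpow (by linarith) (by norm_num) hb
  have hrw : Set.EqOn
      (fun x : ℝ => 2 * (exp (-x ^ 2 / 2) - 1) * (exp (-x ^ 2 / 2) * -x) *
        (x ^ (-2 * H) * (-2 * H)⁻¹))
      (fun x => H⁻¹ * (x ^ (1 - 2 * H) * exp (-1 * x ^ (2 : ℝ)) -
        x ^ (1 - 2 * H) * exp (-(1 / 2) * x ^ (2 : ℝ)))) (Set.Ioi 0) := by
    intro x hx
    have hx0 : 0 < x := hx
    have h1 : x ^ (1 - 2 * H) = x * x ^ (-2 * H) := by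
      rw [show 1 - 2 * H = 1 + -2 * H by ring, rpow_add hx0, rpow_one]
    have h2 : exp (-1 * x ^ (2 : ℝ)) = exp (-x ^ 2 / 2) * exp (-x ^ 2 / 2) := by
      rw [← exp_add, rpow_ofNat]
      congr 1
      ring
    have h3 : -(1 / 2) * x ^ (2 : ℝ) = -x ^ 2 / 2 := by
      rw [rpow_ofNat]
      ring
    simp only [h1, h2, h3]
    field_simp
  have hint := ((hgauss 1 one_pos).sub (hgauss (1 / 2) (by norm_num))).const_mul H⁻¹
  have hlim0 := (tendsto_sq_exp_neg_sq_div_two_sub_one_mul_rpow_nhdsGT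
    (s := -2 * H) (by linarith)).mul_const (-2 * H)⁻¹
  have hlim1 := (tendsto_sq_exp_neg_sq_div_two_sub_one_mul_rpow_atTop
    (s := -2 * H) (by linarith)).mul_const (-2 * H)⁻¹
  simp only [mul_assoc _ _ (-2 * H)⁻¹] at hlim0 hlim1
  rw [integral_Ioi_mul_deriv_eq_deriv_mul (fun x _ => hu x) hv
      (integrableOn_sq_exp_neg_sq_div_two_sub_one_mul_rpow (by linarith) (by linarith))
      (IntegrableOn.congr_fun hint hrw.symm measurableSet_Ioi) hlim0 hlim1,
    setIntegral_congr_fun measurableSet_Ioi hrw, integral_const_mul,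
    integral_sub (hgauss 1 one_pos) (hgauss (1 / 2) (by norm_num)),
    integral_rpow_mul_exp_neg_mul_rpow two_pos (by linarith) one_pos,
    integral_rpow_mul_exp_neg_mul_rpow two_pos (by linarith) (by norm_num : (0 : ℝ) < 1 / 2),
    show (1 - 2 * H + 1) / 2 = 1 - H by ring,
    show -(1 - 2 * H + 1) / 2 = -(1 - H) by ring, one_rpow, one_div, inv_rpow zero_le_two,
    rpow_neg zero_le_two (1 - H), inv_inv, sub_eq_add_neg 1 H, rpow_add two_pos, rpow_one]
  ring
end

section
/- Let $H \in (0,1)$, $\kappa > 0$ and $\varepsilon > 0$. Then $\int_0^{\infty} \int_{\mathbb{R}} e^{-\kappa s \xi^2}\left(1-e^{-\kappa \varepsilon \xi^2/2}\right)^2 |\xi|^{1-2H}\, d\xi\, ds = \Gamma(1-H)\, H^{-1}\, (2^{1-H}-1)\, \kappa^{H-1}\, \varepsilon^{H}$. -/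
open MeasureTheory Real

theorem tendsto_add_rpow_sub_rpow_atTop {H c : ℝ} (h0 : 0 ≤ H) (h1 : H < 1) (hc : 0 ≤ c) :
    Filter.Tendsto (fun s : ℝ => (s + c) ^ H - s ^ H) Filter.atTop (nhds 0) := by
  have hlim : Filter.Tendsto (fun s : ℝ => H * c * s ^ (-(1 - H))) Filter.atTop (nhds 0) := by
    simpa using (tendsto_rpow_neg_atTop (sub_pos.2 h1)).const_mul (H * c)
  refine squeeze_zero' ?_ ?_ hlim
  · filter_upwards [Filter.eventually_gt_atTop (0 : ℝ)] with s hs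
    exact sub_nonneg.2 (rpow_le_rpow hs.le (by linarith) h0)
  · filter_upwards [Filter.eventually_gt_atTop (0 : ℝ)] with s hs
    have hcs : 0 ≤ c / s := by positivity
    have hb := rpow_one_add_le_one_add_mul_self (s := c / s) (by linarith) h0 h1.le
    have hsplit : s + c = s * (1 + c / s) := by field_simp
    have hpow : s ^ (-(1 - H)) = s ^ H / s := by
      rw [neg_sub, rpow_sub_one hs.ne']
    rw [hsplit, mul_rpow hs.le (by positivity), hpow]
    have := mul_le_mul_of_nonneg_left hb (rpow_nonneg hs.le H)
    calc s ^ H * (1 + c / s) ^ H - s ^ H ≤ s ^ H * (1 + H * (c / s)) - s ^ H := by linarith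
      _ = H * c * (s ^ H / s) := by ring

theorem integral_Ioi_rpow_mul_exp_neg_mul_sq {H b : ℝ} (hH : H < 1) (hb : 0 < b) :
    ∫ x in Set.Ioi (0 : ℝ), x ^ (1 - 2 * H) * exp (-b * x ^ 2) =
      Gamma (1 - H) * b ^ (H - 1) / 2 := by
  have h := integral_rpow_mul_exp_neg_mul_rpow (p := 2) (q := 1 - 2 * H) two_pos
    (by linarith) hb
  simp only [rpow_two] at h
  rw [h, show (1 - 2 * H + 1) / 2 = 1 - H by ring,
    show -(1 - 2 * H + 1) / 2 = H - 1 by ring]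
  ring

theorem integral_exp_mul_one_sub_exp_sq_mul_abs_rpow {H κ ε s : ℝ} (hH : H < 1) (hκ : 0 < κ)
    (hε : 0 < ε) (hs : 0 < s) :
    ∫ ξ : ℝ, exp (-κ * s * ξ ^ 2) * (1 - exp (-κ * ε * ξ ^ 2 / 2)) ^ 2 * |ξ| ^ (1 - 2 * H) =
      Gamma (1 - H) * κ ^ (H - 1) *
        (s ^ (H - 1) - 2 * (s + ε / 2) ^ (H - 1) + (s + ε) ^ (H - 1)) := by
  have habs := integral_comp_abs (f := fun x : ℝ =>
    exp (-κ * s * x ^ 2) * (1 - exp (-κ * ε * x ^ 2 / 2)) ^ 2 * x ^ (1 - 2 * H))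
  simp only [sq_abs] at habs
  have hexpand (x : ℝ) :
      exp (-κ * s * x ^ 2) * (1 - exp (-κ * ε * x ^ 2 / 2)) ^ 2 * x ^ (1 - 2 * H) =
        x ^ (1 - 2 * H) * exp (-(κ * s) * x ^ 2)
          - 2 * (x ^ (1 - 2 * H) * exp (-(κ * (s + ε / 2)) * x ^ 2))
          + x ^ (1 - 2 * H) * exp (-(κ * (s + ε)) * x ^ 2) := by
    rw [show -(κ * (s + ε / 2)) * x ^ 2 = -κ * s * x ^ 2 + -κ * ε * x ^ 2 / 2 by ring,
      show -(κ * (s + ε)) * x ^ 2 =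
        -κ * s * x ^ 2 + (-κ * ε * x ^ 2 / 2 + -κ * ε * x ^ 2 / 2) by ring,
      show -(κ * s) * x ^ 2 = -κ * s * x ^ 2 by ring, exp_add, exp_add, exp_add]
    ring
  have hgauss {b : ℝ} (hb : 0 < b) : Integrable (fun x : ℝ => x ^ (1 - 2 * H) * exp (-b * x ^ 2))
      (volume.restrict (Set.Ioi 0)) :=
    integrableOn_rpow_mul_exp_neg_mul_sq hb (by linarith)
  have h1 : 0 < κ * s := by positivity
  have h2 : 0 < κ * (s + ε / 2) := by positivity
  have h3 : 0 < κ * (s + ε) := by positivity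
  have h12 : Integrable (fun x : ℝ => x ^ (1 - 2 * H) * exp (-(κ * s) * x ^ 2)
      - 2 * (x ^ (1 - 2 * H) * exp (-(κ * (s + ε / 2)) * x ^ 2)))
      (volume.restrict (Set.Ioi 0)) :=
    (hgauss h1).sub ((hgauss h2).const_mul 2)
  rw [habs]
  simp only [hexpand]
  rw [integral_add h12 (hgauss h3),
    integral_sub (hgauss h1) ((hgauss h2).const_mul 2), integral_const_mul,
    integral_Ioi_rpow_mul_exp_neg_mul_sq hH h1, integral_Ioi_rpow_mul_exp_neg_mul_sq hH h2,
    integral_Ioi_rpow_mul_exp_neg_mul_sq hH h3, mul_rpow hκ.le hs.le,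
    mul_rpow hκ.le (by positivity), mul_rpow hκ.le (by positivity)]
  ring

theorem full_double_integral_J1 (H κ ε : ℝ) (hH : H ∈ Set.Ioo (0:ℝ) 1)
    (hκ : 0 < κ) (hε : 0 < ε) :
    ∫ s in Set.Ioi (0:ℝ), ∫ ξ : ℝ,
        Real.exp (-κ * s * ξ^2) * (1 - Real.exp (-κ * ε * ξ^2 / 2))^2 * |ξ| ^ (1 - 2*H) =
      Real.Gamma (1 - H) * H⁻¹ * ((2:ℝ) ^ (1 - H) - 1) * κ ^ (H - 1) * ε ^ H := by
  obtain ⟨hH0, hH1⟩ := hH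
  have hinner (s : ℝ) (hs : s ∈ Set.Ioi (0 : ℝ)) :=
    integral_exp_mul_one_sub_exp_sq_mul_abs_rpow hH1 hκ hε hs
  set C := Gamma (1 - H) * κ ^ (H - 1) with hC
  let F : ℝ → ℝ := fun s => C * H⁻¹ * (s ^ H - 2 * (s + ε / 2) ^ H + (s + ε) ^ H)
  have hcont : ContinuousWithinAt F (Set.Ici 0) 0 := by
    have hpow (c : ℝ) : Continuous fun s : ℝ => (s + c) ^ H :=
      (continuous_id.add continuous_const).rpow_const fun _ => Or.inr hH0.le
    exact (continuous_const.mul (((continuous_id.rpow_const fun _ => Or.inr hH0.le).sub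
      (continuous_const.mul (hpow _))).add (hpow _))).continuousWithinAt
  have hderiv (s : ℝ) (hs : s ∈ Set.Ioi (0 : ℝ)) : HasDerivAt F
      (C * (s ^ (H - 1) - 2 * (s + ε / 2) ^ (H - 1) + (s + ε) ^ (H - 1))) s := by
    have hs' : 0 < s := hs
    have hpow {c : ℝ} (hc : 0 ≤ c) :
        HasDerivAt (fun s : ℝ => (s + c) ^ H) (H * (s + c) ^ (H - 1)) s := by
      simpa using ((hasDerivAt_id s).add_const c).rpow_const (p := H)
        (Or.inl (by simp only [id]; positivity))
    have h0 := hpow le_rfl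
    simp only [add_zero] at h0
    refine (((h0.sub ((hpow (half_pos hε).le).const_mul 2)).add (hpow hε.le)).const_mul
      (C * H⁻¹)).congr_deriv ?_
    field_simp
  have hlim : Filter.Tendsto F Filter.atTop (nhds 0) := by
    have h := (((tendsto_add_rpow_sub_rpow_atTop hH0.le hH1 hε.le).sub
      ((tendsto_add_rpow_sub_rpow_atTop hH0.le hH1 (half_pos hε).le).const_mul 2)).const_mul
        (C * H⁻¹))
    simp only [mul_zero, sub_zero] at h
    refine h.congr fun s => ?_
    simp only [F]
    ring
  rw [setIntegral_congr_fun measurableSet_Ioi hinner,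
    integral_Ioi_of_hasDerivAt_of_nonneg hcont hderiv (fun s hs => ?_) hlim]
  · simp only [F, hC, zero_add, zero_rpow hH0.ne']
    rw [div_rpow hε.le two_pos.le, rpow_sub two_pos, rpow_one]
    ring
  · rw [← hinner s hs]
    exact integral_nonneg fun ξ => by positivity
end

section
/- Let $H \in (0,1)$, $\kappa > 0$ and $\varepsilon > 0$. Then $\int_{\mathbb{R}} \left(1-e^{-\kappa \varepsilon \xi^2/2}\right)^2 |\xi|^{-1-2H}\, d\xi = \Gamma(1-H)\, H^{-1}\, (2^{1-H}-1)\, (\kappa\varepsilon)^{H}$. -/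
open MeasureTheory Real

lemma one_sub_exp_neg_mul_sq_le {b t : ℝ} (hb : 0 < b) (ht : 0 < t) :
    (1 - exp (-b * t)) ^ 2 ≤ b ^ 2 * t ^ 2 := by
  have h1 := add_one_le_exp (-b * t)
  have h2 : exp (-b * t) ≤ 1 := exp_le_one_iff.mpr (by nlinarith [mul_pos hb ht])
  rw [← mul_pow]
  exact pow_le_pow_left₀ (by linarith) (by linarith) 2

lemma integrableOn_one_sub_exp_sq_mul_rpow {H b : ℝ} (hH : H ∈ Set.Ioo (0 : ℝ) 1) (hb : 0 < b) :
    IntegrableOn (fun t : ℝ => (1 - exp (-b * t)) ^ 2 * t ^ (-1 - H)) (Set.Ioi 0) := by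
  have hmeas : Measurable fun t : ℝ => (1 - exp (-b * t)) ^ 2 * t ^ (-1 - H) := by fun_prop
  rw [← Set.Ioc_union_Ioi_eq_Ioi (zero_le_one' ℝ)]
  refine IntegrableOn.union ?_ ?_
  · have h : IntegrableOn (fun t : ℝ => b ^ 2 * t ^ (1 - H)) (Set.Ioc 0 1) := by
      rw [← intervalIntegrable_iff_integrableOn_Ioc_of_le zero_le_one]
      exact (intervalIntegral.intervalIntegrable_rpow' (by linarith [hH.2])).const_mul _
    refine h.mono' hmeas.aestronglyMeasurable ?_
    refine (ae_restrict_iff' measurableSet_Ioc).mpr (.of_forall fun t ht => ?_)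
    have ht0 : 0 < t := ht.1
    rw [norm_of_nonneg (by positivity)]
    calc (1 - exp (-b * t)) ^ 2 * t ^ (-1 - H) ≤ b ^ 2 * t ^ 2 * t ^ (-1 - H) := by
          gcongr
          exact one_sub_exp_neg_mul_sq_le hb ht0
      _ = b ^ 2 * t ^ (1 - H) := by
          rw [mul_assoc, ← rpow_natCast t 2, ← rpow_add ht0]
          norm_num
          ring_nf
          simp
  · have h : IntegrableOn (fun t : ℝ => t ^ (-1 - H)) (Set.Ioi 1) :=
      integrableOn_Ioi_rpow_of_lt (by linarith [hH.1]) one_pos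
    refine h.mono' hmeas.aestronglyMeasurable ?_
    refine (ae_restrict_iff' measurableSet_Ioi).mpr (.of_forall fun t ht => ?_)
    have ht0 : 0 < t := one_pos.trans ht
    rw [norm_of_nonneg (by positivity)]
    have h2 : exp (-b * t) ≤ 1 := exp_le_one_iff.mpr (by nlinarith [mul_pos hb ht0])
    refine mul_le_of_le_one_left (by positivity) (pow_le_one₀ (by linarith) ?_)
    linarith [exp_pos (-b * t)]

lemma integral_one_sub_exp_sq_mul_rpow {H b : ℝ} (hH : H ∈ Set.Ioo (0 : ℝ) 1) (hb : 0 < b) :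
    ∫ t in Set.Ioi (0 : ℝ), (1 - exp (-b * t)) ^ 2 * t ^ (-1 - H) =
      Gamma (1 - H) * H⁻¹ * ((2 : ℝ) ^ (1 - H) - 1) * (2 * b) ^ H := by
  have hH0 : 0 < H := hH.1
  have hH1 : 0 < 1 - H := sub_pos.mpr hH.2
  have hexp : ∀ c : ℝ, 0 < c → IntegrableOn (fun t : ℝ => t ^ (-H) * exp (-c * t)) (Set.Ioi 0) := by
    intro c hc
    simpa using integrableOn_rpow_mul_exp_neg_mul_rpow (s := -H) (p := 1) (by linarith) one_pos hc
  have hval : ∀ c : ℝ, 0 < c →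
      ∫ t in Set.Ioi (0 : ℝ), t ^ (-H) * exp (-c * t) = c ^ (H - 1) * Gamma (1 - H) := by
    intro c hc
    have h := integral_rpow_mul_exp_neg_mul_rpow (p := 1) (q := -H) one_pos (by linarith) hc
    simp only [rpow_one, div_one, mul_one] at h
    rw [h]
    ring_nf
  have hu : ∀ t ∈ Set.Ioi (0 : ℝ), HasDerivAt (fun t => (1 - exp (-b * t)) ^ 2)
      (2 * b * (exp (-b * t) - exp (-(2 * b) * t))) t := by
    intro t _
    have h := (((hasDerivAt_id t).const_mul (-b)).exp.const_sub 1).pow 2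
    refine h.congr_deriv ?_
    have : exp (-(2 * b) * t) = exp (-b * t) * exp (-b * t) := by rw [← exp_add]; ring_nf
    rw [this]
    simp
    ring
  have hv : ∀ t ∈ Set.Ioi (0 : ℝ), HasDerivAt (fun t : ℝ => -H⁻¹ * t ^ (-H)) (t ^ (-1 - H)) t := by
    intro t ht
    refine ((hasDerivAt_rpow_const (p := -H) (Or.inl (ne_of_gt ht))).const_mul (-H⁻¹)).congr_deriv ?_
    rw [show -H - 1 = -1 - H by ring]
    field_simp
  have hu'v : ∀ t : ℝ, 2 * b * (exp (-b * t) - exp (-(2 * b) * t)) * (-H⁻¹ * t ^ (-H)) =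
      -(2 * b * H⁻¹) * (t ^ (-H) * exp (-b * t) - t ^ (-H) * exp (-(2 * b) * t)) := by
    intro t; ring
  have hzero : Filter.Tendsto
      ((fun t => (1 - exp (-b * t)) ^ 2) * fun t : ℝ => -H⁻¹ * t ^ (-H))
      (nhdsWithin 0 (Set.Ioi 0)) (nhds 0) := by
    have hlim : Filter.Tendsto (fun t : ℝ => b ^ 2 * H⁻¹ * t ^ (2 - H))
        (nhdsWithin 0 (Set.Ioi 0)) (nhds 0) := by
      have h := ((continuousAt_rpow_const 0 (2 - H) (Or.inr (by linarith))).const_mul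
        (b ^ 2 * H⁻¹)).tendsto
      rw [zero_rpow (by linarith), mul_zero] at h
      exact h.mono_left nhdsWithin_le_nhds
    refine squeeze_zero_norm' ?_ hlim
    filter_upwards [self_mem_nhdsWithin] with t ht
    have ht0 : 0 < t := ht
    simp only [Pi.mul_apply, norm_mul, norm_neg]
    rw [norm_of_nonneg (by positivity : 0 ≤ (1 - exp (-b * t)) ^ 2),
      norm_of_nonneg (by positivity : 0 ≤ H⁻¹), norm_of_nonneg (by positivity : 0 ≤ t ^ (-H))]
    calc (1 - exp (-b * t)) ^ 2 * (H⁻¹ * t ^ (-H)) ≤ b ^ 2 * t ^ 2 * (H⁻¹ * t ^ (-H)) := by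
          gcongr
          exact one_sub_exp_neg_mul_sq_le hb ht0
      _ = b ^ 2 * H⁻¹ * t ^ (2 - H) := by
          rw [sub_eq_add_neg, rpow_add ht0, rpow_two]
          ring
  have hinfty : Filter.Tendsto
      ((fun t => (1 - exp (-b * t)) ^ 2) * fun t : ℝ => -H⁻¹ * t ^ (-H))
      Filter.atTop (nhds 0) := by
    have h1 : Filter.Tendsto (fun t => exp (-b * t)) Filter.atTop (nhds 0) :=
      tendsto_exp_atBot.comp (Filter.tendsto_id.const_mul_atTop_of_neg (neg_neg_of_pos hb))
    simpa [Pi.mul_def] using ((h1.const_sub 1).pow 2).mul ((tendsto_rpow_neg_atTop hH0).const_mul (-H⁻¹))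
  have key := integral_Ioi_mul_deriv_eq_deriv_mul hu hv
    (integrableOn_one_sub_exp_sq_mul_rpow hH hb)
    (by
      simp only [Pi.mul_def, hu'v]
      exact ((hexp b hb).sub (hexp (2 * b) (by positivity))).const_mul _) hzero hinfty
  rw [key]
  simp only [hu'v]
  rw [integral_const_mul, integral_sub (hexp b hb) (hexp (2 * b) (by positivity)), hval b hb,
    hval (2 * b) (by positivity), mul_rpow zero_le_two hb.le, mul_rpow zero_le_two hb.le,
    rpow_sub_one two_ne_zero, rpow_sub_one hb.ne', rpow_sub two_pos, rpow_one]
  have : (2 : ℝ) ^ H ≠ 0 := by positivity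
  field_simp
  ring

theorem integral_sq_one_sub_exp_rpow (H κ ε : ℝ) (hH : H ∈ Set.Ioo (0:ℝ) 1)
    (hκ : 0 < κ) (hε : 0 < ε) :
    ∫ ξ : ℝ, (1 - Real.exp (-κ * ε * ξ^2 / 2))^2 * |ξ| ^ (-1 - 2*H) =
      Real.Gamma (1 - H) * H⁻¹ * ((2:ℝ) ^ (1 - H) - 1) * (κ * ε) ^ H := by
  have habs := integral_comp_abs
    (f := fun x : ℝ => (1 - exp (-κ * ε * x ^ 2 / 2)) ^ 2 * x ^ (-1 - 2 * H))
  simp only [sq_abs] at habs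
  have hmain := integral_one_sub_exp_sq_mul_rpow hH (b := κ * ε / 2) (by positivity)
  rw [habs, ← integral_const_mul]
  rw [← integral_comp_rpow_Ioi_of_pos two_pos, mul_div_cancel₀ _ two_ne_zero] at hmain
  rw [← hmain]
  refine setIntegral_congr_fun measurableSet_Ioi fun x hx => ?_
  have hx0 : 0 < x := hx
  have hpow : x ^ (-1 - 2 * H) = x ^ ((2 : ℝ) - 1) * (x ^ (2 : ℝ)) ^ (-1 - H) := by
    rw [← rpow_mul hx0.le, ← rpow_add hx0]
    ring_nf
  have harg : -κ * ε * x ^ 2 / 2 = -(κ * ε / 2) * x ^ (2 : ℝ) := by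
    rw [rpow_two]
    ring
  simp only [smul_eq_mul]
  rw [hpow, harg]
  ring
end

section
/- Let $\alpha \in (0,1)$ and $\xi > 0$. Then $\int_0^{\infty} \frac{1-\cos(\xi z)}{z^{1+\alpha}}\, dz = \alpha^{-1}\, \Gamma(1-\alpha)\, \cos(\pi\alpha/2)\, \xi^{\alpha}$. -/
open MeasureTheory Real

/-- Tonelli's theorem for Bochner integrals: the iterated integrals of a nonnegative function whose
sections are integrable agree, without any joint integrability hypothesis. -/
theorem integral_integral_swap_of_nonneg {X Y : Type*} [MeasurableSpace X] [MeasurableSpace Y]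
    {μ : Measure X} {ν : Measure Y} [SFinite μ] [SFinite ν] {f : X → Y → ℝ}
    (hf : Measurable (Function.uncurry f))
    (hμ : ∀ᵐ x ∂μ, Integrable (f x) ν ∧ 0 ≤ᵐ[ν] f x)
    (hν : ∀ᵐ y ∂ν, Integrable (f · y) μ ∧ 0 ≤ᵐ[μ] (f · y)) :
    ∫ x, ∫ y, f x y ∂ν ∂μ = ∫ y, ∫ x, f x y ∂μ ∂ν := by
  rw [integral_eq_lintegral_of_nonneg_ae
      (hμ.mono fun x hx => integral_nonneg_of_ae hx.2)
      hf.stronglyMeasurable.integral_prod_right.aestronglyMeasurable,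
    integral_eq_lintegral_of_nonneg_ae
      (hν.mono fun y hy => integral_nonneg_of_ae hy.2)
      hf.stronglyMeasurable.integral_prod_left.aestronglyMeasurable,
    lintegral_congr_ae (hμ.mono fun x hx => ofReal_integral_eq_lintegral_ofReal hx.1 hx.2),
    lintegral_congr_ae (hν.mono fun y hy => ofReal_integral_eq_lintegral_ofReal hy.1 hy.2),
    lintegral_lintegral_swap hf.ennreal_ofReal.aemeasurable]

theorem setIntegral_setIntegral_swap_of_nonneg {X Y : Type*} [MeasurableSpace X]
    [MeasurableSpace Y] {μ : Measure X} {ν : Measure Y} [SFinite μ] [SFinite ν] {f : X → Y → ℝ}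
    {s : Set X} {t : Set Y} (hs : MeasurableSet s) (ht : MeasurableSet t)
    (hf : Measurable (Function.uncurry f)) (h_nonneg : ∀ x ∈ s, ∀ y ∈ t, 0 ≤ f x y)
    (hμ : ∀ x ∈ s, IntegrableOn (f x) t ν) (hν : ∀ y ∈ t, IntegrableOn (f · y) s μ) :
    ∫ x in s, ∫ y in t, f x y ∂ν ∂μ = ∫ y in t, ∫ x in s, f x y ∂μ ∂ν := by
  refine integral_integral_swap_of_nonneg hf ?_ ?_
  · filter_upwards [ae_restrict_mem hs] with x hx
    refine ⟨hμ x hx, ?_⟩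
    filter_upwards [ae_restrict_mem ht] with y hy using h_nonneg x hx y hy
  · filter_upwards [ae_restrict_mem ht] with y hy
    refine ⟨hν y hy, ?_⟩
    filter_upwards [ae_restrict_mem hs] with x hx using h_nonneg x hx y hy

theorem integrableOn_exp_neg_mul_Ioi {r : ℝ} (hr : 0 < r) :
    IntegrableOn (fun t : ℝ => exp (-(r * t))) (Set.Ioi 0) := by
  simpa only [neg_mul] using integrableOn_exp_mul_Ioi (neg_lt_zero.2 hr) 0

theorem integral_exp_neg_mul_Ioi_zero {r : ℝ} (hr : 0 < r) :
    ∫ t in Set.Ioi (0 : ℝ), exp (-(r * t)) = 1 / r := by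
  simpa using integral_exp_mul_Ioi (neg_lt_zero.2 hr) 0

theorem integrableOn_rpow_mul_exp_neg_mul_Ioi {s r : ℝ} (hs : -1 < s) (hr : 0 < r) :
    IntegrableOn (fun t : ℝ => t ^ s * exp (-(r * t))) (Set.Ioi 0) := by
  simpa using integrableOn_rpow_mul_exp_neg_mul_rpow hs one_pos hr

theorem integrableOn_one_sub_cos_mul_exp_neg_mul_Ioi (ξ : ℝ) {t : ℝ} (ht : 0 < t) :
    IntegrableOn (fun z : ℝ => (1 - cos (ξ * z)) * exp (-(t * z))) (Set.Ioi 0) := by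
  refine (integrableOn_exp_neg_mul_Ioi ht).bdd_mul (c := 2) (by fun_prop)
    (.of_forall fun z => ?_)
  rw [Real.norm_eq_abs, abs_le]
  constructor <;> linarith [cos_le_one (ξ * z), neg_one_le_cos (ξ * z)]

/-- The Laplace transform of `1 - cos (ξ z)`. -/
theorem integral_one_sub_cos_mul_exp_neg_mul_Ioi (ξ : ℝ) {t : ℝ} (ht : 0 < t) :
    ∫ z in Set.Ioi (0 : ℝ), (1 - cos (ξ * z)) * exp (-(t * z)) =
      ξ ^ 2 / (t * (t ^ 2 + ξ ^ 2)) := by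
  have hre : (-t + ξ * Complex.I : ℂ).re < 0 := by simpa using ht
  have hint := integrableOn_exp_mul_complex_Ioi hre 0
  have hcos (z : ℝ) :
      (Complex.exp ((-t + ξ * Complex.I) * z)).re = cos (ξ * z) * exp (-(t * z)) := by
    rw [Complex.exp_re]
    simp [mul_comm]
  have h := congrArg Complex.re (integral_exp_mul_complex_Ioi hre 0)
  rw [← RCLike.re_to_complex, ← integral_re hint] at h
  have hint' := hint.re
  simp only [RCLike.re_to_complex, hcos] at h hint'
  simp only [sub_mul, one_mul]
  rw [integral_sub (integrableOn_exp_neg_mul_Ioi ht) hint', h, integral_exp_neg_mul_Ioi_zero ht]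
  simp only [Complex.ofReal_zero, mul_zero, Complex.exp_zero, Complex.div_re, Complex.normSq_apply]
  simp
  field_simp
  ring

theorem integral_rpow_sub_one_div_sq_add_sq {α ξ : ℝ} (hα : α ∈ Set.Ioo (0 : ℝ) 2) (hξ : 0 < ξ) :
    ∫ t in Set.Ioi (0 : ℝ), t ^ (α - 1) / (t ^ 2 + ξ ^ 2) =
      π / (2 * sin (π * α / 2)) * ξ ^ (α - 2) := by
  obtain ⟨hα0, hα2⟩ := hα
  calc
    _ = ∫ t in Set.Ioi (0 : ℝ), ∫ s in Set.Ioi (0 : ℝ),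
          t ^ (α - 1) * exp (-((t ^ 2 + ξ ^ 2) * s)) := by
      refine setIntegral_congr_fun measurableSet_Ioi fun t _ => ?_
      rw [integral_const_mul, integral_exp_neg_mul_Ioi_zero (by positivity), mul_one_div]
    _ = ∫ s in Set.Ioi (0 : ℝ), ∫ t in Set.Ioi (0 : ℝ),
          t ^ (α - 1) * exp (-((t ^ 2 + ξ ^ 2) * s)) := by
      refine setIntegral_setIntegral_swap_of_nonneg measurableSet_Ioi measurableSet_Ioi
        (by unfold Function.uncurry; fun_prop) (fun t ht s _ => ?_) (fun t _ => ?_) fun s hs => ?_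
      · have := Set.mem_Ioi.1 ht
        positivity
      · exact (integrableOn_exp_neg_mul_Ioi (by positivity)).const_mul _
      · refine IntegrableOn.congr_fun ((integrableOn_rpow_mul_exp_neg_mul_sq hs
          (by linarith : -1 < α - 1)).mul_const (exp (-(ξ ^ 2 * s)))) (fun t _ => ?_)
          measurableSet_Ioi
        rw [mul_assoc, ← exp_add]
        ring_nf
    _ = ∫ s in Set.Ioi (0 : ℝ),
          Gamma (α / 2) / 2 * (s ^ ((1 - α / 2) - 1) * exp (-(ξ ^ 2 * s))) := by
      refine setIntegral_congr_fun measurableSet_Ioi fun s hs => ?_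
      have h := integral_rpow_mul_exp_neg_mul_rpow two_pos (by linarith : -1 < α - 1) hs
      simp only [rpow_two] at h
      have hsplit (t : ℝ) : t ^ (α - 1) * exp (-((t ^ 2 + ξ ^ 2) * s)) =
          t ^ (α - 1) * exp (-s * t ^ 2) * exp (-(ξ ^ 2 * s)) := by
        rw [mul_assoc, ← exp_add]
        ring_nf
      simp only [hsplit]
      rw [integral_mul_const, h]
      ring_nf
    _ = Gamma (α / 2) * Gamma (1 - α / 2) / 2 * ξ ^ (α - 2) := by
      rw [integral_const_mul, integral_rpow_mul_exp_neg_mul_Ioi (by linarith) (by positivity),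
        one_div, ← rpow_two, ← rpow_neg hξ.le, ← rpow_mul hξ.le]
      ring_nf
    _ = _ := by
      rw [Gamma_mul_Gamma_one_sub, ← mul_div_assoc, div_div, mul_comm (sin _)]

theorem integral_one_sub_cos_div_rpow (α ξ : ℝ) (hα : α ∈ Set.Ioo (0:ℝ) 1) (hξ : 0 < ξ) :
    ∫ z in Set.Ioi (0:ℝ), (1 - Real.cos (ξ * z)) / z ^ (1 + α) =
      α⁻¹ * Real.Gamma (1 - α) * Real.cos (π * α / 2) * ξ ^ α := by
  obtain ⟨hα0, hα1⟩ := hα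
  have hG : 0 < Gamma (1 + α) := Gamma_pos_of_pos (by linarith)
  have key : Gamma (1 + α) * ∫ z in Set.Ioi (0 : ℝ), (1 - cos (ξ * z)) / z ^ (1 + α) =
      π / (2 * sin (π * α / 2)) * ξ ^ α := by
    calc
      _ = ∫ z in Set.Ioi (0 : ℝ), ∫ t in Set.Ioi (0 : ℝ),
            (1 - cos (ξ * z)) * (t ^ α * exp (-(z * t))) := by
        rw [← integral_const_mul]
        refine setIntegral_congr_fun measurableSet_Ioi fun z hz => ?_
        have h := integral_rpow_mul_exp_neg_mul_Ioi (by linarith : 0 < 1 + α) hz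
        rw [add_sub_cancel_left, one_div, inv_rpow (le_of_lt hz)] at h
        rw [integral_const_mul, h]
        ring
      _ = ∫ t in Set.Ioi (0 : ℝ), ∫ z in Set.Ioi (0 : ℝ),
            (1 - cos (ξ * z)) * (t ^ α * exp (-(z * t))) := by
        refine setIntegral_setIntegral_swap_of_nonneg measurableSet_Ioi measurableSet_Ioi
          (by unfold Function.uncurry; fun_prop) (fun z _ t ht => ?_) (fun z hz => ?_)
          fun t ht => ?_
        · have := Set.mem_Ioi.1 ht
          exact mul_nonneg (sub_nonneg.2 (cos_le_one _)) (by positivity)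
        · exact (integrableOn_rpow_mul_exp_neg_mul_Ioi (by linarith) hz).const_mul _
        · refine IntegrableOn.congr_fun
            ((integrableOn_one_sub_cos_mul_exp_neg_mul_Ioi ξ ht).const_mul (t ^ α))
            (fun z _ => ?_) measurableSet_Ioi
          simp only [mul_comm z t]
          ring
      _ = ∫ t in Set.Ioi (0 : ℝ), ξ ^ 2 * (t ^ (α - 1) / (t ^ 2 + ξ ^ 2)) := by
        refine setIntegral_congr_fun measurableSet_Ioi fun t ht => ?_
        have ht' : 0 < t := ht
        simp only [mul_left_comm _ (t ^ α), mul_comm _ t]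
        rw [integral_const_mul, integral_one_sub_cos_mul_exp_neg_mul_Ioi ξ ht,
          rpow_sub_one ht'.ne']
        field_simp
      _ = _ := by
        rw [integral_const_mul, integral_rpow_sub_one_div_sq_add_sq ⟨hα0, by linarith⟩ hξ,
          rpow_sub hξ, rpow_two]
        field_simp
  have hsin : 0 < sin (π * α / 2) :=
    sin_pos_of_pos_of_lt_pi (by positivity) (by nlinarith [pi_pos])
  have hcos : 0 < cos (π * α / 2) :=
    cos_pos_of_mem_Ioo ⟨by nlinarith [pi_pos], by nlinarith [pi_pos]⟩
  have hrefl := Gamma_mul_Gamma_one_sub α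
  rw [show π * α = 2 * (π * α / 2) by ring, sin_two_mul] at hrefl
  refine mul_left_cancel₀ hG.ne' (key.trans ?_)
  rw [add_comm 1 α, Gamma_add_one hα0.ne']
  calc
    _ = (Gamma α * Gamma (1 - α)) * cos (π * α / 2) * ξ ^ α := by
      rw [hrefl]
      field_simp
    _ = _ := by
      field_simp
end

section
/- Let $\mu \in (0,1)$ and $a > 0$. Then $\lim_{T \to \infty} \int_0^{T} \cos(ax)\, x^{\mu-1}\, dx = \Gamma(\mu)\, a^{-\mu}\, \cos(\pi\mu/2)$. -/
open MeasureTheory Real Filter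

lemma norm_rpow_mul_cexp_neg_mul {m x : ℝ} (hx : 0 < x) (r : ℂ) :
    ‖((x ^ (m - 1) : ℝ) : ℂ) * Complex.exp (-(r * x))‖
      = x ^ (m - 1) * Real.exp (-(r.re * x)) := by
  rw [norm_mul, Complex.norm_exp, Complex.norm_of_nonneg (by positivity)]
  simp

lemma norm_rpow_mul_cexp_neg_mul_le {m x : ℝ} (hx : 0 < x) {r : ℂ} (hr : 0 ≤ r.re) :
    ‖((x ^ (m - 1) : ℝ) : ℂ) * Complex.exp (-(r * x))‖ ≤ x ^ (m - 1) := by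
  rw [norm_rpow_mul_cexp_neg_mul hx]
  exact mul_le_of_le_one_right (by positivity) (Real.exp_le_one_iff.2 (by nlinarith))

lemma continuousOn_rpow_mul_cexp_neg_mul (m : ℝ) (r : ℂ) :
    ContinuousOn (fun x : ℝ => ((x ^ (m - 1) : ℝ) : ℂ) * Complex.exp (-(r * x)))
      (Set.Ioi 0) := by
  refine ContinuousOn.mul (Complex.continuous_ofReal.comp_continuousOn ?_) (by fun_prop)
  exact fun x hx => (continuousAt_rpow_const x _ (Or.inl (ne_of_gt hx))).continuousWithinAt

lemma integrableOn_rpow_mul_exp_neg_mul {m b : ℝ} (hm : 0 < m) (hb : 0 < b) :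
    IntegrableOn (fun x : ℝ => x ^ (m - 1) * Real.exp (-(b * x))) (Set.Ioi 0) := by
  simpa using integrableOn_rpow_mul_exp_neg_mul_rpow (p := 1) (s := m - 1) (b := b)
    (by linarith) one_pos hb

lemma integrableOn_rpow_mul_cexp_neg_mul {m : ℝ} (hm : 0 < m) {r : ℂ} (hr : 0 < r.re) :
    IntegrableOn (fun x : ℝ => ((x ^ (m - 1) : ℝ) : ℂ) * Complex.exp (-(r * x)))
      (Set.Ioi 0) := by
  refine (integrableOn_rpow_mul_exp_neg_mul hm hr).mono'
    ((continuousOn_rpow_mul_cexp_neg_mul m r).aestronglyMeasurable measurableSet_Ioi) ?_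
  filter_upwards [ae_restrict_mem measurableSet_Ioi] with x hx
  exact (norm_rpow_mul_cexp_neg_mul hx r).le

lemma differentiableAt_integral_rpow_mul_cexp_neg_mul {m : ℝ} (hm : 0 < m) {r : ℂ}
    (hr : 0 < r.re) :
    DifferentiableAt ℂ (fun r : ℂ => ∫ x in Set.Ioi (0 : ℝ),
      ((x ^ (m - 1) : ℝ) : ℂ) * Complex.exp (-(r * x))) r := by
  have hs : {z : ℂ | r.re / 2 < z.re} ∈ nhds r :=
    (isOpen_lt continuous_const Complex.continuous_re).mem_nhds (by simpa using hr)
  refine (hasDerivAt_integral_of_dominated_loc_of_deriv_le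
    (F' := fun (z : ℂ) (x : ℝ) => -(((x ^ (m + 1 - 1) : ℝ) : ℂ) * Complex.exp (-(z * x))))
    (bound := fun x : ℝ => x ^ (m + 1 - 1) * Real.exp (-(r.re / 2 * x))) hs
    (.of_forall fun z =>
      (continuousOn_rpow_mul_cexp_neg_mul m z).aestronglyMeasurable measurableSet_Ioi)
    (integrableOn_rpow_mul_cexp_neg_mul hm hr)
    ((continuousOn_rpow_mul_cexp_neg_mul (m + 1) r).aestronglyMeasurable
      measurableSet_Ioi).neg ?_
    (integrableOn_rpow_mul_exp_neg_mul (by linarith) (by linarith)) ?_).2.differentiableAt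
  · filter_upwards [ae_restrict_mem measurableSet_Ioi] with x hx z hz
    have hx : 0 < x := hx
    have hz : r.re / 2 < z.re := hz
    rw [norm_neg, norm_rpow_mul_cexp_neg_mul hx]
    gcongr
  · filter_upwards [ae_restrict_mem measurableSet_Ioi] with x hx z _
    have hx : 0 < x := hx
    have h := ((((hasDerivAt_id z).mul_const (x : ℂ)).neg).cexp).const_mul
      ((x ^ (m - 1) : ℝ) : ℂ)
    convert! h using 1
    rw [show m + 1 - 1 = (m - 1) + 1 by ring, rpow_add_one hx.ne']
    push_cast
    simp
    ring

/-- The Laplace transform of `x ^ (m - 1)` at complex `r` with positive real part. -/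
lemma integral_rpow_mul_cexp_neg_mul_Ioi {m : ℝ} (hm : 0 < m) {r : ℂ} (hr : 0 < r.re) :
    ∫ x in Set.Ioi (0 : ℝ), ((x ^ (m - 1) : ℝ) : ℂ) * Complex.exp (-(r * x))
      = r ^ (-m : ℂ) * Real.Gamma m := by
  have hU : IsOpen {z : ℂ | 0 < z.re} := isOpen_lt continuous_const Complex.continuous_re
  have hF : AnalyticOnNhd ℂ (fun r : ℂ => ∫ x in Set.Ioi (0 : ℝ),
      ((x ^ (m - 1) : ℝ) : ℂ) * Complex.exp (-(r * x))) {z : ℂ | 0 < z.re} :=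
    DifferentiableOn.analyticOnNhd (fun z hz =>
      (differentiableAt_integral_rpow_mul_cexp_neg_mul hm hz).differentiableWithinAt) hU
  have hG : AnalyticOnNhd ℂ (fun r : ℂ => r ^ (-m : ℂ) * (Real.Gamma m : ℂ))
      {z : ℂ | 0 < z.re} :=
    DifferentiableOn.analyticOnNhd (fun z hz =>
      ((differentiableAt_id.cpow_const (Or.inl hz)).mul_const _).differentiableWithinAt) hU
  refine hF.eqOn_of_preconnected_of_frequently_eq hG (convex_halfSpace_re_gt 0).isPreconnected
    (z₀ := 1) (by simp) ?_ hr
  have ht : Tendsto (fun t : ℝ => (t : ℂ)) (nhdsWithin 1 (Set.Ioi 1))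
      (nhdsWithin 1 {1}ᶜ) := by
    refine tendsto_nhdsWithin_iff.2 ⟨?_, ?_⟩
    · exact (Complex.continuous_ofReal.tendsto' 1 1 (by simp)).mono_left nhdsWithin_le_nhds
    · filter_upwards [self_mem_nhdsWithin] with t ht
      simpa using ne_of_gt ht
  refine ht.frequently (Eventually.frequently ?_)
  filter_upwards [self_mem_nhdsWithin] with t ht
  have ht : 0 < t := one_pos.trans ht
  have h := integral_rpow_mul_exp_neg_mul_Ioi hm ht
  rw [one_div, inv_rpow ht.le, ← rpow_neg ht.le] at h
  have h' := congrArg (fun y : ℝ => (y : ℂ)) h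
  simp only [Complex.ofReal_mul, Complex.ofReal_cpow ht.le, Complex.ofReal_neg] at h'
  rw [← h', ← integral_complex_ofReal]
  simp

lemma norm_integral_Ioi_rpow_mul_cexp_neg_mul_le {m : ℝ} (hm : m ∈ Set.Ioo (0 : ℝ) 1) {r : ℂ}
    (hr : 0 < r.re) {T : ℝ} (hT : 0 < T) :
    ‖∫ x in Set.Ioi T, ((x ^ (m - 1) : ℝ) : ℂ) * Complex.exp (-(r * x))‖
      ≤ 2 * T ^ (m - 1) / ‖r‖ := by
  obtain ⟨hm0, hm1⟩ := hm
  have hr0 : r ≠ 0 := by rintro rfl; simp at hr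
  have hsub : Set.Ioi T ⊆ Set.Ioi 0 := Set.Ioi_subset_Ioi hT.le
  have hint := (integrableOn_rpow_mul_cexp_neg_mul hm0 hr).mono_set hsub
  have hdom : IntegrableOn (fun x : ℝ => x ^ (m - 1 - 1)) (Set.Ioi T) :=
    integrableOn_Ioi_rpow_of_lt (by linarith) hT
  have hle : ∀ x ∈ Set.Ioi T,
      ‖((x ^ (m - 1 - 1) : ℝ) : ℂ) * Complex.exp (-(r * x))‖ ≤ x ^ (m - 1 - 1) :=
    fun x hx => norm_rpow_mul_cexp_neg_mul_le (hT.trans hx) hr.le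
  have hint' : IntegrableOn
      (fun x : ℝ => ((x ^ (m - 1 - 1) : ℝ) : ℂ) * Complex.exp (-(r * x))) (Set.Ioi T) :=
    hdom.mono' (((continuousOn_rpow_mul_cexp_neg_mul (m - 1) r).mono hsub).aestronglyMeasurable
      measurableSet_Ioi) ((ae_restrict_mem measurableSet_Ioi).mono hle)
  have hparts : ∫ x in Set.Ioi T, (((m - 1 : ℝ) : ℂ) *
        (((x ^ (m - 1 - 1) : ℝ) : ℂ) * Complex.exp (-(r * x)))
        - r * (((x ^ (m - 1) : ℝ) : ℂ) * Complex.exp (-(r * x))))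
      = 0 - ((T ^ (m - 1) : ℝ) : ℂ) * Complex.exp (-(r * T)) := by
    refine integral_Ioi_of_hasDerivAt_of_tendsto'
      (f := fun x : ℝ => ((x ^ (m - 1) : ℝ) : ℂ) * Complex.exp (-(r * x)))
      (fun x hx => ?_) ((hint'.const_mul _).sub (hint.const_mul _)) ?_
    · have hx : x ≠ 0 := (hT.trans_le hx).ne'
      have h1 := (hasDerivAt_rpow_const (p := m - 1) (Or.inl hx)).ofReal_comp
      have h2 := (((hasDerivAt_id x).ofReal_comp.const_mul r).neg).cexp
      convert! h1.mul h2 using 1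
      push_cast
      simp
      ring
    · refine squeeze_zero_norm' (a := fun x : ℝ => x ^ (-(1 - m))) ?_
        (tendsto_rpow_neg_atTop (by linarith))
      filter_upwards [eventually_gt_atTop 0] with x hx
      rw [neg_sub]
      exact norm_rpow_mul_cexp_neg_mul_le hx hr.le
  rw [integral_sub (hint'.const_mul _) (hint.const_mul _), integral_const_mul,
    integral_const_mul] at hparts
  set I := ∫ x in Set.Ioi T, ((x ^ (m - 1) : ℝ) : ℂ) * Complex.exp (-(r * x))
  set J := ∫ x in Set.Ioi T, ((x ^ (m - 1 - 1) : ℝ) : ℂ) * Complex.exp (-(r * x))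
  have hJ : ‖J‖ ≤ T ^ (m - 1) / (1 - m) := by
    refine (norm_integral_le_of_norm_le hdom
      ((ae_restrict_mem measurableSet_Ioi).mono hle)).trans_eq ?_
    rw [integral_Ioi_rpow_of_lt (by linarith) hT, sub_add_cancel, ← neg_div_neg_eq]
    simp
  have hI : r * I = ((m - 1 : ℝ) : ℂ) * J
      + ((T ^ (m - 1) : ℝ) : ℂ) * Complex.exp (-(r * T)) := by
    linear_combination -hparts
  rw [le_div_iff₀ (norm_pos_iff.2 hr0), mul_comm, ← norm_mul, hI]
  refine (norm_add_le _ _).trans ?_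
  rw [norm_mul ((m - 1 : ℝ) : ℂ), Complex.norm_real, Real.norm_eq_abs,
    abs_of_neg (by linarith), two_mul]
  refine add_le_add ?_ (norm_rpow_mul_cexp_neg_mul_le hT hr.le)
  rw [le_div_iff₀ (by linarith)] at hJ
  linarith

lemma norm_integral_Ioo_rpow_mul_cexp_sub_le_of_re_pos {m : ℝ} (hm : m ∈ Set.Ioo (0 : ℝ) 1)
    {r : ℂ} (hr : 0 < r.re) {T : ℝ} (hT : 0 < T) :
    ‖(∫ x in Set.Ioo 0 T, ((x ^ (m - 1) : ℝ) : ℂ) * Complex.exp (-(r * x)))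
      - r ^ (-m : ℂ) * Real.Gamma m‖ ≤ 2 * T ^ (m - 1) / ‖r‖ := by
  have hint := integrableOn_rpow_mul_cexp_neg_mul hm.1 hr
  rw [← integral_rpow_mul_cexp_neg_mul_Ioi hm.1 hr, ← Set.Ioc_union_Ioi_eq_Ioi hT.le,
    setIntegral_union (Set.Ioc_disjoint_Ioi le_rfl) measurableSet_Ioi
      (hint.mono_set Set.Ioc_subset_Ioi_self) (hint.mono_set (Set.Ioi_subset_Ioi hT.le)),
    integral_Ioc_eq_integral_Ioo, sub_add_cancel_left, norm_neg]
  exact norm_integral_Ioi_rpow_mul_cexp_neg_mul_le hm hr hT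

lemma integrableOn_Ioo_rpow_sub_one {m : ℝ} (hm : 0 < m) (T : ℝ) :
    IntegrableOn (fun x : ℝ => x ^ (m - 1)) (Set.Ioo 0 T) :=
  (intervalIntegral.intervalIntegrable_rpow' (by linarith)).1.mono_set Set.Ioo_subset_Ioc_self

lemma aestronglyMeasurable_Ioo_rpow_mul_cexp_neg_mul (m : ℝ) (r : ℂ) (T : ℝ) :
    AEStronglyMeasurable (fun x : ℝ => ((x ^ (m - 1) : ℝ) : ℂ) * Complex.exp (-(r * x)))
      (volume.restrict (Set.Ioo 0 T)) :=
  ((continuousOn_rpow_mul_cexp_neg_mul m r).mono Set.Ioo_subset_Ioi_self).aestronglyMeasurable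
    measurableSet_Ioo

/-- The truncated Laplace integral of `x ^ (m - 1)` approximates the full one uniformly up to the
imaginary axis. -/
lemma norm_integral_Ioo_rpow_mul_cexp_sub_le {m : ℝ} (hm : m ∈ Set.Ioo (0 : ℝ) 1)
    {r : ℂ} (hr : 0 ≤ r.re) (hr0 : r ≠ 0) {T : ℝ} (hT : 0 < T) :
    ‖(∫ x in Set.Ioo 0 T, ((x ^ (m - 1) : ℝ) : ℂ) * Complex.exp (-(r * x)))
      - r ^ (-m : ℂ) * Real.Gamma m‖ ≤ 2 * T ^ (m - 1) / ‖r‖ := by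
  have hlim : Tendsto (fun ε : ℝ => r + ε) (nhdsWithin 0 (Set.Ioi 0)) (nhds r) :=
    ((by fun_prop : Continuous fun ε : ℝ => r + ε).tendsto' 0 r (by simp)).mono_left
      nhdsWithin_le_nhds
  have hslit : r ∈ Complex.slitPlane := by
    rcases hr.lt_or_eq with h | h
    · exact Or.inl h
    · exact Or.inr fun h' => hr0 (Complex.ext h.symm h')
  have hcpow := ((continuousAt_cpow_const (b := (-m : ℂ)) hslit).tendsto.comp hlim).mul_const
    (Real.Gamma m : ℂ)
  have hdct : Tendsto (fun ε : ℝ => ∫ x in Set.Ioo 0 T,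
        ((x ^ (m - 1) : ℝ) : ℂ) * Complex.exp (-((r + ε) * x))) (nhdsWithin 0 (Set.Ioi 0))
      (nhds (∫ x in Set.Ioo 0 T, ((x ^ (m - 1) : ℝ) : ℂ) * Complex.exp (-(r * x)))) := by
    refine tendsto_integral_filter_of_dominated_convergence (fun x : ℝ => x ^ (m - 1))
      (.of_forall fun ε => aestronglyMeasurable_Ioo_rpow_mul_cexp_neg_mul m _ T) ?_
      (integrableOn_Ioo_rpow_sub_one hm.1 T)
      (.of_forall fun x => ((hlim.mul_const (x : ℂ)).neg.cexp).const_mul _)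
    filter_upwards [self_mem_nhdsWithin] with ε hε
    filter_upwards [ae_restrict_mem measurableSet_Ioo] with x hx
    have hε : 0 < ε := hε
    exact norm_rpow_mul_cexp_neg_mul_le hx.1 (by simp; linarith)
  refine le_of_tendsto_of_tendsto (hdct.sub hcpow).norm
    (tendsto_const_nhds.div hlim.norm (norm_ne_zero_iff.2 hr0)) ?_
  filter_upwards [self_mem_nhdsWithin] with ε hε
  have hε : 0 < ε := hε
  exact norm_integral_Ioo_rpow_mul_cexp_sub_le_of_re_pos hm (by simp; linarith) hT

lemma re_mul_I_cpow_neg {a : ℝ} (ha : 0 < a) (m : ℝ) :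
    ((a * Complex.I) ^ (-m : ℂ)).re = a ^ (-m) * Real.cos (π * m / 2) := by
  have h0 : (a : ℂ) * Complex.I ≠ 0 := by simp [ha.ne']
  rw [Complex.cpow_def_of_ne_zero h0, Complex.log_ofReal_mul ha Complex.I_ne_zero,
    Complex.log_I, rpow_def_of_pos ha, ← Real.cos_neg, Complex.exp_re]
  congr 2
  · simp
  · simp
    ring

theorem cos_rpow_integral_tendsto (μ a : ℝ) (hμ : μ ∈ Set.Ioo (0:ℝ) 1) (ha : 0 < a) :
    Tendsto (fun T : ℝ => ∫ x in Set.Ioo (0:ℝ) T, Real.cos (a * x) * x ^ (μ - 1))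
      atTop (nhds (Real.Gamma μ * a ^ (-μ) * Real.cos (π * μ / 2))) := by
  have hre : ((a : ℂ) * Complex.I).re = 0 := by simp
  have hbound : Tendsto (fun T : ℝ => 2 * T ^ (μ - 1) / a) atTop (nhds 0) := by
    have h := tendsto_rpow_neg_atTop (by linarith [hμ.2] : 0 < 1 - μ)
    simpa using (h.const_mul 2).div_const a
  rw [tendsto_iff_norm_sub_tendsto_zero]
  refine squeeze_zero' (.of_forall fun _ => norm_nonneg _) ?_ hbound
  filter_upwards [eventually_gt_atTop 0] with T hT
  have h := norm_integral_Ioo_rpow_mul_cexp_sub_le hμ hre.ge (by simp [ha.ne']) hT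
  have hint : IntegrableOn (fun x : ℝ =>
      ((x ^ (μ - 1) : ℝ) : ℂ) * Complex.exp (-(a * Complex.I * x))) (Set.Ioo 0 T) :=
    (integrableOn_Ioo_rpow_sub_one hμ.1 T).mono'
      (aestronglyMeasurable_Ioo_rpow_mul_cexp_neg_mul μ _ T)
      ((ae_restrict_mem measurableSet_Ioo).mono fun x hx =>
        norm_rpow_mul_cexp_neg_mul_le hx.1 hre.ge)
  have hcos : (∫ x in Set.Ioo (0 : ℝ) T, Real.cos (a * x) * x ^ (μ - 1))
      = (∫ x in Set.Ioo (0 : ℝ) T,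
        ((x ^ (μ - 1) : ℝ) : ℂ) * Complex.exp (-(a * Complex.I * x))).re := by
    refine Eq.trans ?_ (integral_re hint)
    refine integral_congr_ae (.of_forall fun x => ?_)
    simp [Complex.exp_re, mul_comm]
  rw [norm_mul, Complex.norm_I, mul_one, Complex.norm_of_nonneg ha.le] at h
  refine le_trans ?_ h
  refine le_trans (le_of_eq ?_) (Complex.abs_re_le_norm _)
  rw [Complex.sub_re, ← hcos, Complex.re_mul_ofReal, re_mul_I_cpow_neg ha, Real.norm_eq_abs]
  congr 2
  ring
end

section
/- Let $H \in (1/2,1)$, $\kappa > 0$ and $\varepsilon > 0$. Then $\frac{2\,\Gamma(2H-1)\,\sin(H\pi)\, H\,(2H-1)}{\pi} \int_0^{\infty} \int_{\mathbb{R}} e^{-\kappa s \xi^2}\,(1-\cos(\xi\varepsilon))\, |\xi|^{1-2H}\, d\xi\, ds = \kappa^{-1}\, \varepsilon^{2H}$. -/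
open MeasureTheory Real

/-- Tonelli's theorem on the open quadrant for real-valued functions, together with the
integrability of the other marginal. -/
lemma integrableOn_and_integral_eq_of_marginals {F : ℝ → ℝ → ℝ} {g h : ℝ → ℝ}
    (hF : Measurable (Function.uncurry F))
    (hF0 : ∀ x > 0, ∀ t > 0, 0 ≤ F x t)
    (hg : ∀ x > 0, ∫ t in Set.Ioi 0, F x t = g x)
    (hFh : ∀ t > 0, IntegrableOn (fun x => F x t) (Set.Ioi 0))
    (hh : ∀ t > 0, ∫ x in Set.Ioi 0, F x t = h t)
    (hhi : IntegrableOn h (Set.Ioi 0)) :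
    IntegrableOn g (Set.Ioi 0) ∧ ∫ x in Set.Ioi 0, g x = ∫ t in Set.Ioi 0, h t := by
  have hprod : Integrable (Function.uncurry F)
      ((volume.restrict (Set.Ioi 0)).prod (volume.restrict (Set.Ioi 0))) := by
    rw [integrable_prod_iff' hF.aestronglyMeasurable]
    refine ⟨?_, ?_⟩
    · filter_upwards [ae_restrict_mem measurableSet_Ioi] with t ht
      exact hFh t ht
    · refine hhi.congr ?_
      filter_upwards [ae_restrict_mem measurableSet_Ioi] with t ht
      rw [← hh t ht]
      refine setIntegral_congr_fun measurableSet_Ioi fun x hx => ?_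
      exact (Real.norm_of_nonneg (hF0 x hx t ht)).symm
  have hgae : ∀ᵐ x ∂(volume.restrict (Set.Ioi (0 : ℝ))), ∫ t in Set.Ioi 0, F x t = g x := by
    filter_upwards [ae_restrict_mem measurableSet_Ioi] with x hx using hg x hx
  refine ⟨hprod.integral_prod_left.congr hgae, ?_⟩
  rw [← integral_congr_ae hgae, integral_integral_swap hprod]
  exact setIntegral_congr_fun measurableSet_Ioi hh

lemma integral_exp_neg_mul_Ioi_zero_s16 {b : ℝ} (hb : 0 < b) :
    ∫ x in Set.Ioi (0 : ℝ), Real.exp (-b * x) = b⁻¹ := by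
  rw [integral_exp_mul_Ioi (neg_lt_zero.mpr hb)]
  simp

/-- The Mellin transform of `t ↦ (1 + t ^ 2)⁻¹`. -/
lemma integral_rpow_mul_inv_one_add_sq {a : ℝ} (ha0 : 0 < a) (ha2 : a < 2) :
    IntegrableOn (fun t : ℝ => t ^ (a - 1) * (1 + t ^ 2)⁻¹) (Set.Ioi 0) ∧
      ∫ t in Set.Ioi (0 : ℝ), t ^ (a - 1) * (1 + t ^ 2)⁻¹ = π / 2 / Real.sin (π * (a / 2)) := by
  have hval : ∫ u in Set.Ioi (0 : ℝ),
      Real.Gamma (a / 2) / 2 * (u ^ ((1 - a / 2) - 1) * Real.exp (-(1 * u))) =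
        π / 2 / Real.sin (π * (a / 2)) := by
    rw [integral_const_mul, Real.integral_rpow_mul_exp_neg_mul_Ioi (by linarith) one_pos,
      div_right_comm, ← Real.Gamma_mul_Gamma_one_sub]
    simp
    ring
  have hpos : 0 < π / 2 / Real.sin (π * (a / 2)) :=
    div_pos (by positivity)
      (Real.sin_pos_of_pos_of_lt_pi (by positivity) (by nlinarith [Real.pi_pos]))
  rw [← hval]
  refine integrableOn_and_integral_eq_of_marginals
    (F := fun t u => t ^ (a - 1) * Real.exp (-(1 + t ^ 2) * u)) ?_ ?_ ?_ ?_ ?_ ?_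
  · unfold Function.uncurry
    fun_prop
  · intro t ht u hu
    positivity
  · intro t ht
    rw [integral_const_mul, integral_exp_neg_mul_Ioi_zero_s16 (by positivity)]
  · intro u hu
    have := (integrableOn_rpow_mul_exp_neg_mul_sq hu (s := a - 1) (by linarith)).mul_const
      (Real.exp (-u))
    refine IntegrableOn.congr_fun this (fun t _ => ?_) measurableSet_Ioi
    simp only [mul_assoc, ← Real.exp_add]
    ring_nf
  · intro u hu
    have h := integral_rpow_mul_exp_neg_mul_rpow (p := 2) (q := a - 1) (b := u) two_pos
      (by linarith) hu
    have : ∀ t : ℝ, t ^ (a - 1) * Real.exp (-(1 + t ^ 2) * u) =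
        t ^ (a - 1) * Real.exp (-u * t ^ (2 : ℝ)) * Real.exp (-u) := fun t => by
      rw [mul_assoc, ← Real.exp_add, Real.rpow_two]
      ring_nf
    simp only [this]
    rw [integral_mul_const, h]
    ring_nf
  · exact Integrable.of_integral_ne_zero (by rw [hval]; exact hpos.ne')

/-- The Laplace transform of `x ↦ 1 - cos x`. -/
lemma integral_one_sub_cos_mul_exp_neg {t : ℝ} (ht : 0 < t) :
    ∫ x in Set.Ioi (0 : ℝ), (1 - Real.cos x) * Real.exp (-t * x) = t⁻¹ * (1 + t ^ 2)⁻¹ := by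
  have hre : (-t + Complex.I : ℂ).re < 0 := by simpa using ht
  have hpt : ∀ x : ℝ, RCLike.re (Complex.exp ((-t + Complex.I) * x)) =
      Real.cos x * Real.exp (-t * x) := fun x => by
    simp [Complex.exp_re, mul_comm]
  have hi := integrableOn_exp_mul_complex_Ioi hre 0
  have hc := integral_re hi
  have hci := hi.re
  rw [integral_exp_mul_complex_Ioi hre] at hc
  simp only [hpt] at hc hci
  have hs : ∀ x : ℝ, (1 - Real.cos x) * Real.exp (-t * x) =
      Real.exp (-t * x) - Real.cos x * Real.exp (-t * x) := fun x => by ring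
  simp only [hs]
  rw [integral_sub (integrableOn_exp_mul_Ioi (neg_lt_zero.mpr ht) 0) hci, hc,
    integral_exp_neg_mul_Ioi_zero_s16 ht]
  have h1 : (1 + t ^ 2) ≠ 0 := by positivity
  simp [Complex.div_re, Complex.normSq_apply]
  have h2 : t * t + 1 ≠ 0 := by positivity
  field_simp
  ring

lemma integral_one_sub_cos_mul_rpow {a : ℝ} (ha0 : 0 < a) (ha2 : a < 2) :
    IntegrableOn (fun x : ℝ => (1 - Real.cos x) * x ^ (-1 - a)) (Set.Ioi 0) ∧
      ∫ x in Set.Ioi (0 : ℝ), (1 - Real.cos x) * x ^ (-1 - a) =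
        π / 2 / Real.sin (π * (a / 2)) / Real.Gamma (a + 1) := by
  obtain ⟨hi, hval⟩ := integral_rpow_mul_inv_one_add_sq ha0 ha2
  have hΓ : 0 < Real.Gamma (a + 1) := Real.Gamma_pos_of_pos (by linarith)
  rw [← hval, ← integral_div]
  refine integrableOn_and_integral_eq_of_marginals
    (F := fun x t => (1 - Real.cos x) * Real.exp (-t * x) * t ^ a / Real.Gamma (a + 1))
    ?_ ?_ ?_ ?_ ?_ (hi.div_const _)
  · unfold Function.uncurry
    fun_prop
  · intro x hx t ht
    have := Real.cos_le_one x
    have : 0 ≤ 1 - Real.cos x := by linarith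
    positivity
  · intro x hx
    have h := Real.integral_rpow_mul_exp_neg_mul_Ioi (a := a + 1) (r := x) (by linarith) hx
    have hs : ∀ t : ℝ, (1 - Real.cos x) * Real.exp (-t * x) * t ^ a / Real.Gamma (a + 1) =
        (1 - Real.cos x) / Real.Gamma (a + 1) *
          (t ^ (a + 1 - 1) * Real.exp (-(x * t))) := fun t => by
      rw [add_sub_cancel_right]
      ring_nf
    simp only [hs]
    rw [integral_const_mul, h, one_div, Real.inv_rpow hx.le, ← Real.rpow_neg hx.le]
    field_simp
    ring_nf
  · intro t ht
    refine Integrable.div_const (Integrable.mul_const (Integrable.of_integral_ne_zero ?_) _) _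
    rw [integral_one_sub_cos_mul_exp_neg ht]
    positivity
  · intro t ht
    rw [integral_div, integral_mul_const, integral_one_sub_cos_mul_exp_neg ht,
      Real.rpow_sub_one ht.ne']
    ring

lemma integral_one_sub_cos_mul_const_mul_rpow {a ε : ℝ} (ha0 : 0 < a) (ha2 : a < 2)
    (hε : 0 < ε) :
    IntegrableOn (fun x : ℝ => (1 - Real.cos (x * ε)) * x ^ (-1 - a)) (Set.Ioi 0) ∧
      ∫ x in Set.Ioi (0 : ℝ), (1 - Real.cos (x * ε)) * x ^ (-1 - a) =
        ε ^ a * (π / 2 / Real.sin (π * (a / 2)) / Real.Gamma (a + 1)) := by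
  obtain ⟨hi, hval⟩ := integral_one_sub_cos_mul_rpow ha0 ha2
  have hs : Set.EqOn
      (fun x : ℝ => ε ^ (1 + a) * ((1 - Real.cos (x * ε)) * (x * ε) ^ (-1 - a)))
      (fun x : ℝ => (1 - Real.cos (x * ε)) * x ^ (-1 - a)) (Set.Ioi 0) := fun x hx => by
    have h1 : ε ^ (1 + a) * ε ^ (-1 - a) = 1 := by
      rw [← Real.rpow_add hε]
      simp
    simp only [Real.mul_rpow (le_of_lt hx) hε.le]
    linear_combination (1 - Real.cos (x * ε)) * x ^ (-1 - a) * h1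
  refine ⟨IntegrableOn.congr_fun (Integrable.const_mul ?_ _) hs measurableSet_Ioi, ?_⟩
  · exact (integrableOn_Ioi_comp_mul_right_iff
      (fun y : ℝ => (1 - Real.cos y) * y ^ (-1 - a)) 0 hε).mpr (by simpa using hi)
  · rw [← setIntegral_congr_fun measurableSet_Ioi hs, integral_const_mul,
      integral_comp_mul_right_Ioi (fun y : ℝ => (1 - Real.cos y) * y ^ (-1 - a)) 0 hε, zero_mul,
      hval, smul_eq_mul, Real.rpow_add hε, Real.rpow_one]
    field_simp

theorem spatial_increment_variance_smooth (H κ ε : ℝ) (hH : H ∈ Set.Ioo (1/2:ℝ) 1)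
    (hκ : 0 < κ) (hε : 0 < ε) :
    (2 * Real.Gamma (2*H - 1) * Real.sin (H * π) * H * (2*H - 1)) / π *
      ∫ s in Set.Ioi (0:ℝ), ∫ ξ : ℝ,
        Real.exp (-κ * s * ξ^2) * (1 - Real.cos (ξ * ε)) * |ξ| ^ (1 - 2*H) =
      κ⁻¹ * ε ^ (2*H) := by
  obtain ⟨hH1, hH2⟩ := hH
  obtain ⟨hi, hval⟩ := integral_one_sub_cos_mul_const_mul_rpow (a := 2 * H) (by linarith)
    (by linarith) hε
  have habs : ∀ s : ℝ, ∫ ξ : ℝ,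
      Real.exp (-κ * s * ξ^2) * (1 - Real.cos (ξ * ε)) * |ξ| ^ (1 - 2*H) =
      2 * ∫ ξ in Set.Ioi (0 : ℝ),
        Real.exp (-κ * s * ξ^2) * (1 - Real.cos (ξ * ε)) * ξ ^ (1 - 2*H) := fun s => by
    rw [← integral_comp_abs (f := fun ξ : ℝ =>
      Real.exp (-κ * s * ξ^2) * (1 - Real.cos (ξ * ε)) * ξ ^ (1 - 2*H))]
    congr 1
    ext ξ
    rw [sq_abs, ← Real.cos_abs (ξ * ε), ← Real.cos_abs (|ξ| * ε), abs_mul, abs_mul, abs_abs]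
  have hfib : ∀ ξ > 0, ∫ s in Set.Ioi (0 : ℝ),
      Real.exp (-κ * s * ξ^2) * (1 - Real.cos (ξ * ε)) * ξ ^ (1 - 2*H) =
      κ⁻¹ * ((1 - Real.cos (ξ * ε)) * ξ ^ (-1 - 2*H)) := fun ξ hξ => by
    have hs : ∀ s, -κ * s * ξ^2 = -(κ * ξ^2) * s := fun s => by ring
    simp only [hs]
    rw [integral_mul_const, integral_mul_const, integral_exp_neg_mul_Ioi_zero_s16 (by positivity),
      show 1 - 2 * H = (-1 - 2 * H) + (2 : ℕ) by push_cast; ring, Real.rpow_add_natCast hξ.ne']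
    field_simp
  have hswap := (integrableOn_and_integral_eq_of_marginals
    (F := fun s ξ => Real.exp (-κ * s * ξ^2) * (1 - Real.cos (ξ * ε)) * ξ ^ (1 - 2*H))
    (by unfold Function.uncurry; fun_prop)
    (fun s _ ξ hξ => by
      have := Real.cos_le_one (ξ * ε)
      have : 0 ≤ 1 - Real.cos (ξ * ε) := by linarith
      positivity)
    (fun s _ => rfl)
    (fun ξ hξ => by
      have hs : ∀ s, -κ * s * ξ^2 = -(κ * ξ^2) * s := fun s => by ring
      simp only [hs]
      exact ((integrableOn_exp_mul_Ioi (neg_lt_zero.mpr (by positivity)) 0).mul_const _).mul_const _)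
    hfib (hi.const_mul _)).2
  simp only [habs]
  rw [integral_const_mul, hswap, integral_const_mul, hval]
  have hsin : Real.sin (H * π) ≠ 0 :=
    (Real.sin_pos_of_pos_of_lt_pi (by positivity) (by nlinarith [Real.pi_pos])).ne'
  have hΓ : Real.Gamma (2 * H - 1) ≠ 0 := (Real.Gamma_pos_of_pos (by linarith)).ne'
  have hH0 : H ≠ 0 := by linarith
  have hH' : 2 * H - 1 ≠ 0 := by linarith
  have hrec : Real.Gamma (2 * H) = (2 * H - 1) * Real.Gamma (2 * H - 1) := by
    rw [← Real.Gamma_add_one hH', sub_add_cancel]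
  rw [Real.Gamma_add_one (by positivity), hrec, show π * (2 * H / 2) = H * π by ring]
  field_simp
end
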